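/- Let L = F_q with q = 2^n, let k ≥ 2, and let f(x) = x^{2^{2k}+1} + h(x) ∈ L[x] where h(x) = Σ_{j=0}^{2^{2k-1}+2} a_j x^j has degree exactly 2^{2k-1}+2. Suppose there exists an index j ≥ 3 with a_j ≠ 0 such that φ_{2^{2k}+1} and φ_j are relatively prime (have no nonconstant common factor over the algebraic closure of L). Then φ(x,y,z) is absolutely irreducible. -/

import Mathlib

open MvPolynomial

/-- The polynomial `(x+y)(x+z)(y+z)` in `L[x,y,z]` (variables `X 0, X 1, X 2`). -/
noncomputable def delta3 (L : Type) [CommRing L] : MvPolynomial (Fin 3) L :=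
  (X 0 + X 1) * (X 0 + X 2) * (X 1 + X 2)

/-- The numerator `f(x) + f(y) + f(z) + f(x+y+z)` of `φ`, as an element of `L[x,y,z]`. -/
noncomputable def phiNum {L : Type} [CommRing L] (f : Polynomial L) :
    MvPolynomial (Fin 3) L :=
  Polynomial.aeval (X 0 : MvPolynomial (Fin 3) L) f +
    Polynomial.aeval (X 1 : MvPolynomial (Fin 3) L) f +
    Polynomial.aeval (X 2 : MvPolynomial (Fin 3) L) f +
    Polynomial.aeval (X 0 + X 1 + X 2 : MvPolynomial (Fin 3) L) f

/-- The numerator `x^j + y^j + z^j + (x+y+z)^j` of `φ_j`, as an element of `L[x,y,z]`. -/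
noncomputable def phiJNum (L : Type) [CommRing L] (j : ℕ) : MvPolynomial (Fin 3) L :=
  X 0 ^ j + X 1 ^ j + X 2 ^ j + (X 0 + X 1 + X 2) ^ j

/-- A polynomial over a field `L` is absolutely irreducible if it is irreducible over
the algebraic closure of `L`. -/
def AbsolutelyIrreducible {L : Type} [Field L] (p : MvPolynomial (Fin 3) L) : Prop :=
  Irreducible (MvPolynomial.map (algebraMap L (AlgebraicClosure L)) p)


namespace MvPolynomial

/-- A nonzero linear form over a field is prime. -/
lemma IsHomogeneous.prime_of_one {σ K : Type*} [Field K] {p : MvPolynomial σ K}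
    (hp : p.IsHomogeneous 1) (h0 : p ≠ 0) : Prime p := by
  refine (irreducible_of_totalDegree_eq_one (hp.totalDegree h0) fun x hx ↦ ?_).prime
  obtain ⟨d, hd⟩ := ne_zero_iff.mp h0
  exact isUnit_of_dvd_unit (hx d) hd.isUnit

/-- A homogeneous polynomial divisible by a nonzero homogeneous polynomial of larger degree
vanishes. -/
lemma IsHomogeneous.eq_zero_of_dvd {σ K : Type*} [Field K] {p q : MvPolynomial σ K} {m n : ℕ}
    (hp : p.IsHomogeneous m) (hq : q.IsHomogeneous n) (hp0 : p ≠ 0) (hnm : n < m)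
    (hpq : p ∣ q) : q = 0 := by
  by_contra hq0
  obtain ⟨r, rfl⟩ := hpq
  have h := hq.totalDegree hq0
  rw [totalDegree_mul_of_isDomain hp0 (right_ne_zero_of_mul hq0), hp.totalDegree hp0] at h
  omega

/-- The homogenization `p(x) ↦ p(T x)`; its coefficients in `T` are the homogeneous
components of `p`. -/
noncomputable def gradeHom (σ K : Type*) [CommRing K] :
    MvPolynomial σ K →ₐ[K] Polynomial (MvPolynomial σ K) :=
  aeval fun i ↦ Polynomial.C (X i) * Polynomial.X

section gradeHom

variable {σ K : Type*} [CommRing K]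

@[simp]
lemma gradeHom_X (i : σ) : gradeHom σ K (X i) = Polynomial.C (X i) * Polynomial.X := by
  simp [gradeHom]

lemma gradeHom_C (a : K) : gradeHom σ K (C a) = Polynomial.C (C a) := by
  simp [gradeHom, algHom_C, Polynomial.algebraMap_apply, algebraMap_eq]

lemma isHomogeneous_coeff_gradeHom (p : MvPolynomial σ K) (i : ℕ) :
    ((gradeHom σ K p).coeff i).IsHomogeneous i := by
  induction p using MvPolynomial.induction_on generalizing i with
  | C a =>
    rw [gradeHom_C, Polynomial.coeff_C]
    split_ifs with h
    · exact h ▸ isHomogeneous_C _ _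
    · exact isHomogeneous_zero _ _ _
  | add p q hp hq =>
    rw [map_add, Polynomial.coeff_add]
    exact (hp i).add (hq i)
  | mul_X p n hp =>
    rw [map_mul, gradeHom_X, ← mul_assoc]
    cases i with
    | zero => simpa using isHomogeneous_zero _ _ _
    | succ i =>
      rw [Polynomial.coeff_mul_X, Polynomial.coeff_mul_C]
      exact (hp i).mul (isHomogeneous_X _ _)

@[simp]
lemma eval_one_gradeHom (p : MvPolynomial σ K) : (gradeHom σ K p).eval 1 = p := by
  induction p using MvPolynomial.induction_on with
  | C a => simp
  | add p q hp hq => simp [hp, hq]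
  | mul_X p n hp => simp [hp]

end gradeHom

end MvPolynomial

namespace Polynomial

lemma coeff_mul_of_coeff_eq_zero {R : Type*} [CommSemiring R] {p q : R[X]} {i : ℕ} (hi : 0 < i)
    (h : ∀ j, 0 < j → j < i → p.coeff j = 0 ∧ q.coeff j = 0) :
    (p * q).coeff i = p.coeff 0 * q.coeff i + p.coeff i * q.coeff 0 := by
  obtain ⟨i, rfl⟩ := Nat.exists_eq_succ_of_ne_zero hi.ne'
  rw [coeff_mul, Finset.Nat.sum_antidiagonal_eq_sum_range_succ_mk, Finset.sum_range_succ,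
    Finset.sum_range_succ', Finset.sum_eq_zero, zero_add]
  · simp
  · intro j hj
    rw [Finset.mem_range] at hj
    simp [(h (j + 1) (by omega) (by omega)).1]

lemma isHomogeneous_reverse_coeff {σ K : Type*} [CommRing K] {p : (MvPolynomial σ K)[X]}
    (hp : ∀ i, (p.coeff i).IsHomogeneous i) (i : ℕ) :
    (p.reverse.coeff i).IsHomogeneous (p.natDegree - i) := by
  rw [coeff_reverse]
  rcases le_or_gt i p.natDegree with h | h
  · rw [revAt_le h]
    exact hp _
  · rw [← coeff_reverse, coeff_eq_zero_of_natDegree_lt (p.reverse_natDegree_le.trans_lt h)]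
    exact MvPolynomial.isHomogeneous_zero _ _ _

/-- If the leading forms of `p` and `q` are relatively prime, a gap below the leading form of
`p * q` forces the same gap in both factors. -/
lemma reverse_coeff_eq_zero_of_gap {σ K : Type*} [Field K] {p q : (MvPolynomial σ K)[X]}
    (hp : ∀ i, (p.coeff i).IsHomogeneous i)
    (hp0 : p ≠ 0) (hq0 : q ≠ 0) (hpq : IsRelPrime p.leadingCoeff q.leadingCoeff) {e : ℕ}
    (h : ∀ i, 0 < i → i < e → (p * q).reverse.coeff i = 0) (i : ℕ) (hi : 0 < i) (hie : i < e) :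
    p.reverse.coeff i = 0 ∧ q.reverse.coeff i = 0 := by
  induction i using Nat.strong_induction_on with
  | _ i ih =>
    have hlp := leadingCoeff_ne_zero.mpr hp0
    have hlq := leadingCoeff_ne_zero.mpr hq0
    have key := h i hi hie
    rw [reverse_mul_of_domain, coeff_mul_of_coeff_eq_zero hi
      fun j hj hji ↦ ih j hji hj (hji.trans hie), coeff_zero_reverse, coeff_zero_reverse] at key
    have hpi : p.reverse.coeff i = 0 := by
      rcases le_or_gt i p.natDegree with hle | hlt
      · refine (hp _).eq_zero_of_dvd (isHomogeneous_reverse_coeff hp i) hlp (by omega) ?_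
        refine hpq.dvd_of_dvd_mul_right (Dvd.intro (-q.reverse.coeff i) ?_)
        linear_combination -key
      · exact coeff_eq_zero_of_natDegree_lt (p.reverse_natDegree_le.trans_lt hlt)
    refine ⟨hpi, ?_⟩
    simpa [hpi, hlp] using key

lemma eq_C_mul_X_pow_of_reverse_coeff {R : Type*} [Semiring R] {p : R[X]}
    (h : ∀ i, 0 < i → p.reverse.coeff i = 0) :
    p = C p.leadingCoeff * X ^ p.natDegree := by
  ext i
  rw [coeff_C_mul_X_pow]
  split_ifs with hi
  · rw [hi, leadingCoeff]
  · rcases lt_or_gt_of_ne hi with hlt | hgt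
    · have := h (p.natDegree - i) (by omega)
      rwa [coeff_reverse, revAt_le (by omega), Nat.sub_sub_self hlt.le] at this
    · exact coeff_eq_zero_of_natDegree_lt hgt

end Polynomial

lemma gradeHom_delta3 (K : Type) [CommRing K] :
    gradeHom (Fin 3) K (delta3 K) = Polynomial.C (delta3 K) * Polynomial.X ^ 3 := by
  simp only [delta3, map_mul, map_add, gradeHom_X]
  ring

lemma phiNum_add {K : Type} [CommRing K] (f g : Polynomial K) :
    phiNum (f + g) = phiNum f + phiNum g := by
  simp only [phiNum, map_add]
  ring

lemma phiNum_monomial {K : Type} [CommRing K] (i : ℕ) (a : K) :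
    phiNum (Polynomial.monomial i a) = C a * phiJNum K i := by
  simp only [phiNum, phiJNum, Polynomial.aeval_monomial, algebraMap_eq]
  ring

lemma gradeHom_phiJNum (K : Type) [CommRing K] (i : ℕ) :
    gradeHom (Fin 3) K (phiJNum K i) = Polynomial.C (phiJNum K i) * Polynomial.X ^ i := by
  simp only [phiJNum, map_add, map_pow, gradeHom_X, ← add_mul, mul_pow]

lemma coeff_gradeHom_phiNum {K : Type} [CommRing K] (f : Polynomial K) (i : ℕ) :
    (gradeHom (Fin 3) K (phiNum f)).coeff i = C (f.coeff i) * phiJNum K i := by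
  induction f using Polynomial.induction_on' with
  | add f g hf hg =>
    rw [phiNum_add, map_add, Polynomial.coeff_add, hf, hg, Polynomial.coeff_add, C_add, add_mul]
  | monomial n a =>
    rw [phiNum_monomial, map_mul, gradeHom_C, gradeHom_phiJNum, ← mul_assoc, ← map_mul,
      Polynomial.coeff_C_mul_X_pow, Polynomial.coeff_monomial]
    by_cases h : n = i
    · simp [h]
    · simp [h, Ne.symm h]

/-- The homogeneous component of degree `i` of `φ` is `a_{i+3} φ_{i+3}`. -/
lemma delta3_mul_coeff_gradeHom {K : Type} [CommRing K] {f : Polynomial K}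
    {φ : MvPolynomial (Fin 3) K} (hφ : delta3 K * φ = phiNum f) (i : ℕ) :
    delta3 K * (gradeHom (Fin 3) K φ).coeff i = C (f.coeff (i + 3)) * phiJNum K (i + 3) := by
  rw [← coeff_gradeHom_phiNum, ← hφ, map_mul, gradeHom_delta3, mul_assoc,
    Polynomial.coeff_C_mul, mul_comm (Polynomial.X ^ 3),
    Polynomial.coeff_mul_X_pow]

section Gold

variable {K : Type} [Field K]

lemma prime_linearForm {a b c : K} (h : a ≠ 0) :
    Prime (C a * X 0 + C b * X 1 + C c * X 2 : MvPolynomial (Fin 3) K) := by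
  refine IsHomogeneous.prime_of_one (((isHomogeneous_C_mul_X _ _).add
    (isHomogeneous_C_mul_X _ _)).add (isHomogeneous_C_mul_X _ _)) fun h0 ↦ h ?_
  simpa using congr_arg (eval ![1, 0, 0]) h0

lemma delta3_ne_zero : delta3 K ≠ 0 := fun h ↦ by
  simpa [delta3] using congr_arg (eval ![1, 0, 0] ∘ pderiv 1) h

variable [CharP K 2]

lemma phiJNum_two_pow_add_one (m : ℕ) :
    phiJNum K (2 ^ m + 1) =
      (X 0 + X 2) ^ 2 ^ m * (X 1 + X 2) + (X 0 + X 2) * (X 1 + X 2) ^ 2 ^ m := by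
  have h2 : (2 : MvPolynomial (Fin 3) K) = 0 := CharTwo.two_eq_zero
  simp only [phiJNum, pow_succ _ (2 ^ m), add_pow_char_pow]
  linear_combination (X 0 ^ 2 ^ m * X 0 + X 1 ^ 2 ^ m * X 1) * h2

lemma squarefree_phiJNum_two_pow_add_one {m : ℕ} (hm : 0 < m) :
    Squarefree (phiJNum K (2 ^ m + 1)) := by
  intro g hg
  have h2 : ((2 ^ m : ℕ) : MvPolynomial (Fin 3) K) = 0 := by
    rw [Nat.cast_pow, Nat.cast_ofNat, CharTwo.two_eq_zero, zero_pow hm.ne']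
  have hder (i : Fin 3) : g ∣ pderiv i (phiJNum K (2 ^ m + 1)) := by
    obtain ⟨r, hr⟩ := hg
    rw [hr, Derivation.leibniz, Derivation.leibniz]
    simp only [smul_eq_mul]
    exact ⟨g * pderiv i r + r * (2 * pderiv i g), by ring⟩
  have h0 : g ∣ (X 1 + X 2) ^ 2 ^ m := by
    have := hder 0
    rw [phiJNum_two_pow_add_one] at this
    simpa [Derivation.leibniz_pow, h2, pderiv_X] using this
  have h1 : g ∣ (X 0 + X 2) ^ 2 ^ m := by
    have := hder 1
    rw [phiJNum_two_pow_add_one] at this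
    simpa [Derivation.leibniz_pow, h2, pderiv_X] using this
  have hp : Prime (X 0 + X 2 : MvPolynomial (Fin 3) K) := by
    simpa using prime_linearForm (K := K) (b := 0) (c := 1) one_ne_zero
  refine ((hp.irreducible.isRelPrime_iff_not_dvd.mpr ?_).pow) h1 h0
  rintro ⟨r, hr⟩
  simpa using congr_arg (eval ![0, 1, 0]) hr

/-- For even `m`, the polynomial `φ_{2^m+1}` is divisible by `x + ωy + (1+ω)z`, where `ω` is a
primitive cube root of unity. -/
lemma delta3_mul_dvd_phiJNum {ω : K} (hω : ω ^ 2 + ω + 1 = 0) (m : ℕ) :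
    delta3 K * (C 1 * X 0 + C ω * X 1 + C (1 + ω) * X 2) ∣ phiJNum K (2 ^ (2 * m) + 1) := by
  have h2 : (2 : MvPolynomial (Fin 3) K) = 0 := CharTwo.two_eq_zero
  have hω' : (C ω ^ 2 + C ω + 1 : MvPolynomial (Fin 3) K) = 0 := by
    rw [← C_1, ← C_pow, ← C_add, ← C_add, hω, C_0]
  obtain ⟨r, hr⟩ : 3 ∣ 2 ^ (2 * m) - 1 := by
    simpa [pow_mul] using Nat.sub_dvd_pow_sub_pow 4 1 m
  have hN : 2 ^ (2 * m) = 3 * r + 1 := by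
    have := Nat.one_le_two_pow (n := 2 * m)
    omega
  obtain ⟨s, hs⟩ := sub_dvd_pow_sub_pow ((X 0 + X 2 : MvPolynomial (Fin 3) K) ^ 3)
    ((X 1 + X 2) ^ 3) r
  rw [phiJNum_two_pow_add_one, hN, delta3]
  simp only [CharTwo.sub_eq_add, ← pow_mul] at hs
  refine ⟨((X 0 + X 2) + (1 + C ω) * (X 1 + X 2)) * s, ?_⟩
  have hx : (X 0 + X 2 : MvPolynomial (Fin 3) K) ^ (3 * r + 1) * (X 1 + X 2) +
      (X 0 + X 2) * (X 1 + X 2) ^ (3 * r + 1) =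
      (X 0 + X 2) * (X 1 + X 2) * (((X 0 + X 2) ^ 3 + (X 1 + X 2) ^ 3) * s) := by
    rw [← hs]
    ring
  have hy : (X 0 + X 2 : MvPolynomial (Fin 3) K) ^ 3 + (X 1 + X 2) ^ 3 =
      (X 0 + X 1) * ((C 1 * X 0 + C ω * X 1 + C (1 + ω) * X 2) *
        ((X 0 + X 2) + (1 + C ω) * (X 1 + X 2))) := by
    simp only [C_1, C_add]
    grind
  rw [hx, hy]
  ring

end Gold

/-- A factor of degree less than the gap below the leading form of `p * q` is homogeneous, so it
is a unit if the leading form is relatively prime to another homogeneous component. -/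
lemma isUnit_of_natDegree_gradeHom_lt {σ K : Type*} [Field K] {p q : MvPolynomial σ K} {e i : ℕ}
    (hp : p ≠ 0) (hq : q ≠ 0)
    (hpq : IsRelPrime (gradeHom σ K p).leadingCoeff (gradeHom σ K q).leadingCoeff)
    (hgap : ∀ i, 0 < i → i < e → (gradeHom σ K (p * q)).reverse.coeff i = 0)
    (he : (gradeHom σ K q).natDegree < e)
    (hi : IsRelPrime (gradeHom σ K (p * q)).leadingCoeff ((gradeHom σ K (p * q)).coeff i)) :
    IsUnit q := by
  have hne {r : MvPolynomial σ K} (hr : r ≠ 0) : gradeHom σ K r ≠ 0 := fun h ↦ hr <| by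
    simpa using congr_arg (Polynomial.eval 1) h
  rw [map_mul] at hgap hi
  have hQ := Polynomial.eq_C_mul_X_pow_of_reverse_coeff (p := gradeHom σ K q) fun i hi0 ↦ by
    rcases lt_or_ge i e with hie | hie
    · exact (Polynomial.reverse_coeff_eq_zero_of_gap (isHomogeneous_coeff_gradeHom p)
        (hne hp) (hne hq) hpq hgap i hi0 hie).2
    · exact Polynomial.coeff_eq_zero_of_natDegree_lt
        ((Polynomial.reverse_natDegree_le _).trans_lt (he.trans_le hie))
  have hq' : q = (gradeHom σ K q).leadingCoeff := by
    simpa using congr_arg (Polynomial.eval 1) hQ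
  rw [hq']
  refine hi ?_ ?_
  · rw [Polynomial.leadingCoeff_mul]
    exact dvd_mul_left _ _
  · refine (Polynomial.C_dvd_iff_dvd_coeff _ _).mp ?_ i
    exact ((Dvd.intro _ hQ.symm)).mul_left _

/-- If `l` divides both `p * q` and a nonzero constant combination `c` of the relatively prime
`p` and `q`, then one of the two constants is zero, so every divisor of `c` divides `p * q`. -/
lemma dvd_mul_of_combination {σ K : Type*} [Field K] {p q c l m : MvPolynomial σ K} {a b : K}
    (hpq : IsRelPrime p q) (h : p * C b + C a * q = c) (hc : c ≠ 0) (hl : Prime l)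
    (hlpq : l ∣ p * q) (hlc : l ∣ c) (hmc : m ∣ c) : m ∣ p * q := by
  wlog hlp : l ∣ p generalizing p q a b
  · rw [mul_comm]
    rw [mul_comm] at hlpq
    exact this hpq.symm (a := b) (b := a) (by rw [← h]; ring) hlpq
      ((hl.dvd_or_dvd hlpq).resolve_right hlp)
  have ha : a = 0 := by
    by_contra ha
    refine hl.not_isUnit (hpq hlp ?_)
    rw [← h, dvd_add_right (hlp.mul_right _)] at hlc
    exact (((isUnit_iff_ne_zero.mpr ha).map C).dvd_mul_left).mp hlc
  have hb : b ≠ 0 := by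
    rintro rfl
    exact hc (by simp [← h, ha])
  rw [← h, ha, C_0, zero_mul, add_zero] at hmc
  exact (((hb.isUnit.map C).dvd_mul_right).mp hmc).mul_right _

/-- The statement over a field of characteristic two containing a primitive cube root of unity. -/
theorem irreducible_of_gold_even_exponent {K : Type} [Field K] [CharP K 2] {ω : K}
    (hω : ω ^ 2 + ω + 1 = 0) {k : ℕ} (hk : 2 ≤ k) {h : Polynomial K}
    (hh : h.natDegree = 2 ^ (2 * k - 1) + 2) {j : ℕ} (hj : 3 ≤ j) (hcoeff : h.coeff j ≠ 0)
    {φG φj φ : MvPolynomial (Fin 3) K} (hφG : delta3 K * φG = phiJNum K (2 ^ (2 * k) + 1))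
    (hφj : delta3 K * φj = phiJNum K j) (hrp : IsRelPrime φG φj)
    (hφ : delta3 K * φ = phiNum (Polynomial.X ^ (2 ^ (2 * k) + 1) + h)) : Irreducible φ := by
  obtain ⟨m, rfl⟩ : ∃ m, k = m + 2 := ⟨k - 2, by omega⟩
  obtain ⟨e, he⟩ : ∃ e, 2 ^ (2 * (m + 2) - 1) = e + 1 :=
    Nat.exists_eq_succ_of_ne_zero (by positivity)
  have he2 : 2 ^ (2 * (m + 2)) = 2 * e + 2 := by
    rw [show 2 * (m + 2) = 2 * (m + 2) - 1 + 1 by omega, pow_succ, he]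
    ring
  have he3 : e + 3 = 2 * (2 ^ (2 * (m + 1)) + 1) := by
    rw [show 2 * (m + 2) - 1 = 2 * (m + 1) + 1 by omega, pow_succ] at he
    omega
  have he0 : 0 < e := by
    have := Nat.one_le_two_pow (n := 2 * (m + 1))
    omega
  rw [he] at hh
  have hδ := delta3_ne_zero (K := K)
  have hjd : j ≤ e + 3 := (Polynomial.le_natDegree_of_ne_zero hcoeff).trans hh.le
  set Φ := gradeHom (Fin 3) K φ with hΦ
  have hcomp (i : ℕ) : delta3 K * Φ.coeff i =
      C (if i = 2 * e then 1 else h.coeff (i + 3)) * phiJNum K (i + 3) := by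
    rw [delta3_mul_coeff_gradeHom hφ, Polynomial.coeff_add, Polynomial.coeff_X_pow, he2]
    by_cases hi : i = 2 * e
    · rw [Polynomial.coeff_eq_zero_of_natDegree_lt (by omega : h.natDegree < i + 3)]
      simp [hi]
    · simp [hi]
  have htop : Φ.coeff (2 * e) = φG := by
    refine mul_left_cancel₀ hδ ?_
    rw [hcomp, hφG, he2]
    simp
  have hgap (i : ℕ) (hi : e < i) (hi' : i ≠ 2 * e) : Φ.coeff i = 0 := by
    refine (mul_eq_zero.mp ?_).resolve_left hδ
    rw [hcomp, if_neg hi', Polynomial.coeff_eq_zero_of_natDegree_lt (by omega), C_0, zero_mul]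
  have hsq : Squarefree (delta3 K * φG) := by
    rw [hφG]
    exact squarefree_phiJNum_two_pow_add_one (by omega)
  have hG0 : φG ≠ 0 := right_ne_zero_of_mul hsq.ne_zero
  have hdeg : Φ.natDegree = 2 * e := by
    refine Polynomial.natDegree_eq_of_le_of_coeff_ne_zero ?_ (htop ▸ hG0)
    exact Polynomial.natDegree_le_iff_coeff_eq_zero.mpr fun i hi ↦ hgap i (by omega) (by omega)
  have hlead : Φ.leadingCoeff = φG := by rw [Polynomial.leadingCoeff, hdeg, htop]
  have hrev (i : ℕ) (hi : i ≤ 2 * e) : Φ.reverse.coeff i = Φ.coeff (2 * e - i) := by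
    rw [Polynomial.coeff_reverse, hdeg, Polynomial.revAt_le hi]
  have hrevgap (i : ℕ) (hi0 : 0 < i) (hi : i < e) : Φ.reverse.coeff i = 0 := by
    rw [hrev i (by omega)]
    exact hgap _ (by omega) (by omega)
  have hrel : IsRelPrime Φ.leadingCoeff (Φ.coeff (j - 3)) := by
    have hcj : Φ.coeff (j - 3) = C (h.coeff j) * φj := by
      refine mul_left_cancel₀ hδ ?_
      rw [hcomp, if_neg (by omega), Nat.sub_add_cancel hj, mul_left_comm, hφj]
    rw [hlead, hcj]
    exact (isRelPrime_mul_unit_left_right (hcoeff.isUnit.map C)).mpr hrp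
  have hφ0 : φ ≠ 0 := by
    rintro rfl
    rw [hΦ, map_zero, Polynomial.leadingCoeff_zero] at hlead
    exact hG0 hlead.symm
  refine ⟨fun hu ↦ ?_, fun P Q hPQ ↦ ?_⟩
  · have := Polynomial.natDegree_eq_zero_of_isUnit (hu.map (gradeHom (Fin 3) K))
    rw [← hΦ, hdeg] at this
    omega
  have hP0 : P ≠ 0 := left_ne_zero_of_mul (hPQ ▸ hφ0)
  have hQ0 : Q ≠ 0 := right_ne_zero_of_mul (hPQ ▸ hφ0)
  have hΦPQ : Φ = gradeHom (Fin 3) K P * gradeHom (Fin 3) K Q := by rw [hΦ, hPQ, map_mul]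
  have hΦ0 : Φ ≠ 0 := fun h ↦ by simp [h] at hdeg; omega
  have hleadPQ : (gradeHom (Fin 3) K P).leadingCoeff * (gradeHom (Fin 3) K Q).leadingCoeff = φG := by
    rw [← Polynomial.leadingCoeff_mul, ← hΦPQ, hlead]
  have hrelPQ :
      IsRelPrime (gradeHom (Fin 3) K P).leadingCoeff (gradeHom (Fin 3) K Q).leadingCoeff := by
    intro d hdP hdQ
    refine hsq d ((mul_dvd_mul hdP hdQ).trans ?_)
    rw [hleadPQ]
    exact dvd_mul_left _ _
  have hdegPQ : (gradeHom (Fin 3) K P).natDegree + (gradeHom (Fin 3) K Q).natDegree = 2 * e := by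
    rw [← Polynomial.natDegree_mul (left_ne_zero_of_mul (hΦPQ ▸ hΦ0))
      (right_ne_zero_of_mul (hΦPQ ▸ hΦ0)), ← hΦPQ, hdeg]
  rcases lt_trichotomy (gradeHom (Fin 3) K Q).natDegree e with hQe | hQe | hQe
  · rw [hΦ, hPQ] at hrevgap hrel
    exact Or.inr (isUnit_of_natDegree_gradeHom_lt hP0 hQ0 hrelPQ hrevgap hQe hrel)
  · exfalso
    obtain ⟨r, hr⟩ := delta3_mul_dvd_phiJNum hω (m + 1)
    obtain ⟨s, hs⟩ := delta3_mul_dvd_phiJNum hω (m + 2)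
    have hPe : (gradeHom (Fin 3) K P).natDegree = e := by omega
    have ha : h.coeff (e + 3) ≠ 0 := by
      rw [show e + 3 = h.natDegree by omega]
      exact Polynomial.leadingCoeff_ne_zero.mpr fun h0 ↦ by simp [h0] at hcoeff
    have hnum : phiJNum K (e + 3) = phiJNum K (2 ^ (2 * (m + 1)) + 1) ^ 2 := by
      rw [he3]
      simp only [phiJNum, CharTwo.add_sq, pow_mul']
    have hc := hcomp e
    rw [if_neg (by omega), hnum] at hc
    have hc0 : Φ.coeff e ≠ 0 := by
      refine right_ne_zero_of_mul (hc ▸ mul_ne_zero ?_ (pow_ne_zero 2 ?_))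
      · simpa using ha
      · exact (squarefree_phiJNum_two_pow_add_one (by omega)).ne_zero
    rw [hr, show ∀ a d l r : MvPolynomial (Fin 3) K, a * (d * l * r) ^ 2 = d * (a * d * l ^ 2 * r ^ 2)
      from fun _ _ _ _ ↦ by ring] at hc
    replace hc := mul_left_cancel₀ hδ hc
    rw [← hφG, mul_assoc] at hs
    replace hs := mul_left_cancel₀ hδ hs
    have hkey : Φ.reverse.coeff e = Φ.coeff e := by
      rw [hrev e (by omega), two_mul, Nat.add_sub_cancel]
    rw [hΦPQ] at hrevgap
    rw [hΦPQ, Polynomial.reverse_mul_of_domain, Polynomial.coeff_mul_of_coeff_eq_zero he0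
      (Polynomial.reverse_coeff_eq_zero_of_gap (isHomogeneous_coeff_gradeHom P)
        (left_ne_zero_of_mul (hΦPQ ▸ hΦ0)) (right_ne_zero_of_mul (hΦPQ ▸ hΦ0)) hrelPQ hrevgap),
      Polynomial.coeff_zero_reverse, Polynomial.coeff_zero_reverse, ← hΦPQ] at hkey
    have hconst {R : MvPolynomial (Fin 3) K} (hR : (gradeHom (Fin 3) K R).natDegree = e) :
        ∃ a, (gradeHom (Fin 3) K R).reverse.coeff e = C a := by
      have := Polynomial.isHomogeneous_reverse_coeff (isHomogeneous_coeff_gradeHom R) e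
      rw [hR, Nat.sub_self, ← totalDegree_zero_iff_isHomogeneous] at this
      exact ⟨_, totalDegree_eq_zero_iff_eq_C.mp this⟩
    obtain ⟨a, ha⟩ := hconst hPe
    obtain ⟨b, hb⟩ := hconst hQe
    rw [ha, hb] at hkey
    have hm : Prime (X 0 + X 1 : MvPolynomial (Fin 3) K) := by
      simpa using prime_linearForm (K := K) (b := 1) (c := 0) one_ne_zero
    have hmδ : (X 0 + X 1 : MvPolynomial (Fin 3) K) ∣ delta3 K :=
      (dvd_mul_right _ _).mul_right _
    have hmG := dvd_mul_of_combination (m := X 0 + X 1) hrelPQ hkey hc0 (prime_linearForm one_ne_zero)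
      (by rw [hleadPQ, hs]; exact dvd_mul_right _ _)
      (by rw [hc]; exact ((dvd_pow_self _ two_ne_zero).mul_left _).mul_right _)
      (by rw [hc]; exact ((hmδ.mul_left _).mul_right _).mul_right _)
    rw [hleadPQ] at hmG
    exact hm.not_isUnit (hsq _ (mul_dvd_mul hmδ hmG))
  · rw [hΦ, hPQ, mul_comm] at hrevgap hrel
    exact Or.inl (isUnit_of_natDegree_gradeHom_lt hQ0 hP0 hrelPQ.symm hrevgap (by omega) hrel)

lemma map_delta3 {L K : Type} [CommRing L] [CommRing K] (g : L →+* K) :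
    MvPolynomial.map g (delta3 L) = delta3 K := by
  simp [delta3]

lemma map_phiJNum {L K : Type} [CommRing L] [CommRing K] (g : L →+* K) (j : ℕ) :
    MvPolynomial.map g (phiJNum L j) = phiJNum K j := by
  simp [phiJNum]

lemma map_phiNum {L K : Type} [CommRing L] [CommRing K] (g : L →+* K) (f : Polynomial L) :
    MvPolynomial.map g (phiNum f) = phiNum (f.map g) := by
  induction f using Polynomial.induction_on' with
  | add p q hp hq =>
    rw [phiNum_add, map_add, hp, hq, Polynomial.map_add, phiNum_add]
  | monomial n a =>
    rw [Polynomial.map_monomial, phiNum_monomial, phiNum_monomial, map_mul, map_C, map_phiJNum]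

/-- Let `L = F_q`, `q = 2^n`, `k ≥ 2`, and `f(x) = x^{2^{2k}+1} + h(x)`
where `deg h = 2^{2k-1} + 2`. If there is `j ≥ 3` with `h.coeff j ≠ 0` such that
`φ_{2^{2k}+1}` and `φ_j` are relatively prime over the algebraic closure of `L`,
then `φ` is absolutely irreducible. -/
theorem gold_even_exponent_boundary_abs_irred {n : ℕ} (hn : 0 < n) (L : Type)
    [Field L] [Fintype L] (hcard : Fintype.card L = 2 ^ n)
    (k : ℕ) (hk : 2 ≤ k) (h : Polynomial L)
    (hh : h.natDegree = 2 ^ (2 * k - 1) + 2)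
    (f : Polynomial L) (hf : f = Polynomial.X ^ (2 ^ (2 * k) + 1) + h)
    (j : ℕ) (hj3 : 3 ≤ j) (hcoeff : h.coeff j ≠ 0)
    (φG : MvPolynomial (Fin 3) L) (hφG : delta3 L * φG = phiJNum L (2 ^ (2 * k) + 1))
    (φj : MvPolynomial (Fin 3) L) (hφj : delta3 L * φj = phiJNum L j)
    (hrp : IsRelPrime (MvPolynomial.map (algebraMap L (AlgebraicClosure L)) φG)
      (MvPolynomial.map (algebraMap L (AlgebraicClosure L)) φj))
    (φ : MvPolynomial (Fin 3) L) (hφ : delta3 L * φ = phiNum f) :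
    AbsolutelyIrreducible φ := by
  have : Fact (Nat.Prime 2) := ⟨Nat.prime_two⟩
  have : CharP L 2 := charP_of_card_eq_prime_pow hcard
  have : CharP (AlgebraicClosure L) 2 := charP_of_injective_algebraMap
    (algebraMap L (AlgebraicClosure L)).injective 2
  set g := algebraMap L (AlgebraicClosure L)
  obtain ⟨ω, hω⟩ : ∃ ω : AlgebraicClosure L, ω ^ 2 + ω + 1 = 0 := by
    obtain ⟨ω, hω⟩ := IsAlgClosed.exists_root
      (Polynomial.X ^ 2 + Polynomial.X + 1 : Polynomial (AlgebraicClosure L))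
      (ne_of_eq_of_ne (b := 2) (by compute_degree!) (by norm_num))
    exact ⟨ω, by simpa [Polynomial.IsRoot] using hω⟩
  refine irreducible_of_gold_even_exponent hω hk (h := h.map g) (j := j)
    (by rw [Polynomial.natDegree_map, hh]) hj3 ?_ (φG := MvPolynomial.map g φG)
    (φj := MvPolynomial.map g φj) ?_ ?_ hrp ?_
  · simpa [Polynomial.coeff_map] using hcoeff
  · rw [← map_delta3 g, ← map_mul, hφG, map_phiJNum]
  · rw [← map_delta3 g, ← map_mul, hφj, map_phiJNum]
  · rw [← map_delta3 g, ← map_mul, hφ, map_phiNum, hf]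
    simp
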